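/- arXiv:2204.13920 — 10 statements merged into one kernel-verified Lean document; each statement's English description precedes it below -/
import Mathlib

section
/- Let I ⊆ {1,…,m} and J ⊆ {1,…,n} be nonempty index sets, let P be a Moore–Penrose pseudoinverse of A_{I,:} and Q a Moore–Penrose pseudoinverse of B_{:,J}, and suppose the sketched matrix equation A_{I,:} Z B_{:,J} = C_{I,J} has at least one solution Z ∈ ℝ^{p×q}. Then for any X ∈ ℝ^{p×q}, the GRBK update X' = X + P (C_{I,J} − A_{I,:} X B_{:,J}) Q satisfies A_{I,:} X' B_{:,J} = C_{I,J}, and ‖X' − X‖_F ≤ ‖Z − X‖_F for every Z ∈ ℝ^{p×q} with A_{I,:} Z B_{:,J} = C_{I,J}; that is, X' is a minimum-Frobenius-distance projection of X onto the solution set of the sketched equation. -/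
open Matrix

noncomputable def vecNormSq {α : Type*} [Fintype α] (x : α → ℝ) : ℝ := ∑ i, (x i) ^ 2

noncomputable def vecNorm {α : Type*} [Fintype α] (x : α → ℝ) : ℝ := Real.sqrt (vecNormSq x)

noncomputable def frobNormSq {α β : Type*} [Fintype α] [Fintype β] (M : Matrix α β ℝ) : ℝ :=
  ∑ i, ∑ j, (M i j) ^ 2

noncomputable def frobNorm {α β : Type*} [Fintype α] [Fintype β] (M : Matrix α β ℝ) : ℝ :=
  Real.sqrt (frobNormSq M)

noncomputable def frobInner {α β : Type*} [Fintype α] [Fintype β] (U V : Matrix α β ℝ) : ℝ :=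
  ∑ i, ∑ j, U i j * V i j

def IsMPInv {α β : Type*} [Fintype α] [Fintype β] (M : Matrix α β ℝ) (P : Matrix β α ℝ) : Prop :=
  M * P * M = M ∧ P * M * P = P ∧ (M * P)ᵀ = M * P ∧ (P * M)ᵀ = P * M

def rowSub {m p : ℕ} (A : Matrix (Fin m) (Fin p) ℝ) (I : Finset (Fin m)) :
    Matrix {i // i ∈ I} (Fin p) ℝ := A.submatrix Subtype.val id

def colSub {q n : ℕ} (B : Matrix (Fin q) (Fin n) ℝ) (J : Finset (Fin n)) :
    Matrix (Fin q) {j // j ∈ J} ℝ := B.submatrix id Subtype.val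

def subMat {m n : ℕ} (C : Matrix (Fin m) (Fin n) ℝ) (I : Finset (Fin m)) (J : Finset (Fin n)) :
    Matrix {i // i ∈ I} {j // j ∈ J} ℝ := C.submatrix Subtype.val Subtype.val

noncomputable def bilin {m p q n : ℕ} (A : Matrix (Fin m) (Fin p) ℝ) (B : Matrix (Fin q) (Fin n) ℝ)
    (X : Matrix (Fin p) (Fin q) ℝ) (i : Fin m) (j : Fin n) : ℝ :=
  ∑ a, ∑ b, A i a * X a b * B b j

def rank1 {m p q n : ℕ} (A : Matrix (Fin m) (Fin p) ℝ) (B : Matrix (Fin q) (Fin n) ℝ)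
    (i : Fin m) (j : Fin n) (s : ℝ) : Matrix (Fin p) (Fin q) ℝ :=
  Matrix.of fun a b => A i a * s * B b j

noncomputable def rowSubNorm {m p : ℕ} (A : Matrix (Fin m) (Fin p) ℝ) (I : Finset (Fin m)) :
    Matrix {i // i ∈ I} (Fin p) ℝ := Matrix.of fun i a => A i.val a / vecNorm (A i.val)

noncomputable def colSubNorm {q n : ℕ} (B : Matrix (Fin q) (Fin n) ℝ) (J : Finset (Fin n)) :
    Matrix (Fin q) {j // j ∈ J} ℝ :=
  Matrix.of fun b j => B b j.val / vecNorm (fun b' => B b' j.val)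

theorem frobNormSq_eq_trace_aux {α β : Type*} [Fintype α] [Fintype β] (M : Matrix α β ℝ) :
    frobNormSq M = (Mᵀ * M).trace := by
  simp only [frobNormSq, Matrix.trace, Matrix.diag, Matrix.mul_apply, Matrix.transpose_apply]
  rw [Finset.sum_comm]
  simp only [sq]

theorem frobNormSq_nonneg_aux {α β : Type*} [Fintype α] [Fintype β] (M : Matrix α β ℝ) :
    0 ≤ frobNormSq M :=
  Finset.sum_nonneg fun _ _ => Finset.sum_nonneg fun _ _ => sq_nonneg _

theorem frobNormSq_transpose_aux {α β : Type*} [Fintype α] [Fintype β] (M : Matrix α β ℝ) :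
    frobNormSq Mᵀ = frobNormSq M := by
  simp only [frobNormSq, Matrix.transpose_apply]
  rw [Finset.sum_comm]

theorem frobNormSq_proj_le_aux {α β : Type*} [Fintype α] [Fintype β]
    (E : Matrix α α ℝ) (hs : Eᵀ = E) (hi : E * E = E) (W : Matrix α β ℝ) :
    frobNormSq (E * W) ≤ frobNormSq W := by
  have h : frobNormSq W = frobNormSq (E * W) + frobNormSq (W - E * W) := by
    simp only [frobNormSq_eq_trace_aux]
    rw [← Matrix.trace_add]
    congr 1
    have h2 : ∀ Y : Matrix α β ℝ, E * (E * Y) = E * Y := fun Y => by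
      rw [← Matrix.mul_assoc, hi]
    simp only [Matrix.transpose_sub, Matrix.transpose_mul, hs, Matrix.sub_mul, Matrix.mul_sub,
      Matrix.mul_assoc, h2]
    abel
  linarith [frobNormSq_nonneg_aux (W - E * W)]

/-- the GRBK update projects `X` onto the solution set of the sketched
matrix equation `A_{I,:} Z B_{:,J} = C_{I,J}`: it satisfies the sketched equation and is
at minimum Frobenius distance from `X` among all its solutions. -/
theorem grbk_update_is_projection {m p q n : ℕ}
    (A : Matrix (Fin m) (Fin p) ℝ) (B : Matrix (Fin q) (Fin n) ℝ)
    (C : Matrix (Fin m) (Fin n) ℝ)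
    (I : Finset (Fin m)) (J : Finset (Fin n)) (hI : I.Nonempty) (hJ : J.Nonempty)
    (P : Matrix (Fin p) {i // i ∈ I} ℝ) (Q : Matrix {j // j ∈ J} (Fin q) ℝ)
    (hP : IsMPInv (rowSub A I) P) (hQ : IsMPInv (colSub B J) Q)
    (hcons : ∃ Z : Matrix (Fin p) (Fin q) ℝ, rowSub A I * Z * colSub B J = subMat C I J)
    (X : Matrix (Fin p) (Fin q) ℝ) :
    rowSub A I * (X + P * (subMat C I J - rowSub A I * X * colSub B J) * Q) * colSub B J
        = subMat C I J ∧
    ∀ Z : Matrix (Fin p) (Fin q) ℝ, rowSub A I * Z * colSub B J = subMat C I J →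
      frobNorm ((X + P * (subMat C I J - rowSub A I * X * colSub B J) * Q) - X)
        ≤ frobNorm (Z - X) := by
  obtain ⟨hP1, hP2, -, hP4⟩ := hP
  obtain ⟨hQ1, hQ2, hQ3, -⟩ := hQ
  generalize rowSub A I = M at *
  generalize colSub B J = N at *
  generalize subMat C I J = K at *
  have key : ∀ Z : Matrix (Fin p) (Fin q) ℝ, M * Z * N = K →
      P * (K - M * X * N) * Q = (P * M) * (Z - X) * (N * Q) := by
    rintro Z rfl
    simp only [Matrix.mul_sub, Matrix.sub_mul, Matrix.mul_assoc]
  refine ⟨?_, fun Z hZ => ?_⟩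
  · obtain ⟨Z, hZ⟩ := hcons
    rw [key Z hZ]
    have : M * (X + P * M * (Z - X) * (N * Q)) * N
        = M * X * N + (M * P * M) * (Z - X) * (N * Q * N) := by
      simp only [Matrix.mul_add, Matrix.add_mul, Matrix.mul_assoc]
    rw [this, hP1, hQ1, Matrix.mul_sub, Matrix.sub_mul, hZ]
    abel
  · rw [add_sub_cancel_left, key Z hZ]
    refine Real.sqrt_le_sqrt ?_
    have hE : (P * M) * (P * M) = P * M := by rw [← Matrix.mul_assoc, hP2]
    have hF : (N * Q) * (N * Q) = N * Q := by rw [← Matrix.mul_assoc, hQ1]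
    rw [Matrix.mul_assoc]
    refine (frobNormSq_proj_le_aux _ hP4 hE _).trans ?_
    rw [← frobNormSq_transpose_aux, Matrix.transpose_mul, hQ3]
    refine (frobNormSq_proj_le_aux _ hQ3 hF _).trans ?_
    rw [frobNormSq_transpose_aux]
end

section
/- Let I ⊆ {1,…,m} and J ⊆ {1,…,n} be nonempty index sets, let P be a Moore–Penrose pseudoinverse of A_{I,:} and Q a Moore–Penrose pseudoinverse of B_{:,J}, and assume A_{I,:} X* B_{:,J} = C_{I,J}. For X ∈ ℝ^{p×q} define the GRBK update X' = X + P (C_{I,J} − A_{I,:} X B_{:,J}) Q. Then there exists Y₀ ∈ ℝ^{|I|×|J|} such that X' = X + (A_{I,:})ᵀ Y₀ (B_{:,J})ᵀ, and for every Y ∈ ℝ^{|I|×|J|} one has ‖X' − X*‖_F ≤ ‖X + (A_{I,:})ᵀ Y (B_{:,J})ᵀ − X*‖_F; that is, X' is the best approximation of X* in the affine subspace {X + (A_{I,:})ᵀ Y (B_{:,J})ᵀ : Y ∈ ℝ^{|I|×|J|}}. -/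
open Matrix

theorem frobNorm_le_aux {α β γ δ : Type*} [Fintype α] [Fintype β] [Fintype γ] [Fintype δ]
    (M : Matrix γ α ℝ) (N : Matrix β δ ℝ) (E : Matrix α β ℝ) (h : M * E * N = 0)
    (Z : Matrix γ δ ℝ) : frobNorm E ≤ frobNorm (E + Mᵀ * Z * Nᵀ) := by
  unfold frobNorm
  apply Real.sqrt_le_sqrt
  have h1 : (Eᵀ * (Mᵀ * Z * Nᵀ)).trace = 0 := by
    have h2 : Nᵀ * (Eᵀ * Mᵀ) = 0 := by
      rw [← Matrix.transpose_mul, ← Matrix.transpose_mul, h, Matrix.transpose_zero]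
    rw [← Matrix.mul_assoc, Matrix.trace_mul_comm, ← Matrix.mul_assoc, ← Matrix.mul_assoc,
      Matrix.mul_assoc Nᵀ, h2, Matrix.zero_mul, Matrix.trace_zero]
  have h3 : ((Mᵀ * Z * Nᵀ)ᵀ * E).trace = 0 := by
    rw [← Matrix.trace_transpose, Matrix.transpose_mul, Matrix.transpose_transpose, h1]
  have h4 : 0 ≤ frobNormSq (Mᵀ * Z * Nᵀ) := by
    unfold frobNormSq
    positivity
  rw [frobNormSq_eq_trace_aux] at h4 ⊢
  rw [frobNormSq_eq_trace_aux, Matrix.transpose_add, Matrix.add_mul, Matrix.mul_add,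
    Matrix.mul_add, Matrix.trace_add, Matrix.trace_add, Matrix.trace_add, h1, h3]
  linarith

/-- the GRBK update is the best approximation of `X*` in the affine
subspace `{X + (A_{I,:})ᵀ Y (B_{:,J})ᵀ : Y}`. -/
theorem grbk_update_best_approximation {m p q n : ℕ}
    (A : Matrix (Fin m) (Fin p) ℝ) (B : Matrix (Fin q) (Fin n) ℝ)
    (Xs : Matrix (Fin p) (Fin q) ℝ) (C : Matrix (Fin m) (Fin n) ℝ) (hC : C = A * Xs * B)
    (I : Finset (Fin m)) (J : Finset (Fin n)) (hI : I.Nonempty) (hJ : J.Nonempty)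
    (P : Matrix (Fin p) {i // i ∈ I} ℝ) (Q : Matrix {j // j ∈ J} (Fin q) ℝ)
    (hP : IsMPInv (rowSub A I) P) (hQ : IsMPInv (colSub B J) Q)
    (hXs : rowSub A I * Xs * colSub B J = subMat C I J)
    (X : Matrix (Fin p) (Fin q) ℝ) :
    (∃ Y₀ : Matrix {i // i ∈ I} {j // j ∈ J} ℝ,
        X + P * (subMat C I J - rowSub A I * X * colSub B J) * Q
          = X + (rowSub A I)ᵀ * Y₀ * (colSub B J)ᵀ) ∧
    ∀ Y : Matrix {i // i ∈ I} {j // j ∈ J} ℝ,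
      frobNorm ((X + P * (subMat C I J - rowSub A I * X * colSub B J) * Q) - Xs)
        ≤ frobNorm (X + (rowSub A I)ᵀ * Y * (colSub B J)ᵀ - Xs) := by
  rw [← hXs]
  generalize rowSub A I = M at *
  generalize colSub B J = N at *
  obtain ⟨hP1, hP2, -, hP4⟩ := hP
  obtain ⟨hQ1, hQ2, hQ3, -⟩ := hQ
  have eP : P = Mᵀ * (Pᵀ * P) := by
    rw [← Matrix.mul_assoc, ← Matrix.transpose_mul, hP4, hP2]
  have eQ : Q = Q * Qᵀ * Nᵀ := by
    rw [Matrix.mul_assoc, ← Matrix.transpose_mul, hQ3, ← Matrix.mul_assoc, hQ2]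
  have key : ∀ R : Matrix {i // i ∈ I} {j // j ∈ J} ℝ,
      P * R * Q = Mᵀ * (Pᵀ * P * R * (Q * Qᵀ)) * Nᵀ := by
    intro R
    calc P * R * Q = (Mᵀ * (Pᵀ * P)) * R * (Q * Qᵀ * Nᵀ) := by rw [← eP, ← eQ]
      _ = _ := by simp only [Matrix.mul_assoc]
  refine ⟨⟨_, by rw [key]⟩, fun Y => ?_⟩
  have hz : ∀ R : Matrix (Fin p) (Fin q) ℝ, M * (P * (M * R * N) * Q) * N = M * R * N := by
    intro R
    calc _ = (M * P * M) * R * (N * Q * N) := by simp only [Matrix.mul_assoc]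
      _ = _ := by rw [hP1, hQ1]
  have hD : M * Xs * N - M * X * N = M * (Xs - X) * N := by
    rw [Matrix.mul_sub, Matrix.sub_mul]
  rw [hD]
  have hE : M * (X + P * (M * (Xs - X) * N) * Q - Xs) * N = 0 := by
    rw [Matrix.mul_sub, Matrix.mul_add, Matrix.sub_mul, Matrix.add_mul, hz, ← hD]
    abel
  have hfin := frobNorm_le_aux M N _ hE (Y - Pᵀ * P * (M * (Xs - X) * N) * (Q * Qᵀ))
  have hW : X + P * (M * (Xs - X) * N) * Q - Xs
      + Mᵀ * (Y - Pᵀ * P * (M * (Xs - X) * N) * (Q * Qᵀ)) * Nᵀ = X + Mᵀ * Y * Nᵀ - Xs := by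
    rw [Matrix.mul_sub Mᵀ, Matrix.sub_mul (Mᵀ * Y), ← key]
    abel
  rw [hW] at hfin
  exact hfin
end

section
/- Let I ⊆ {1,…,m} and J ⊆ {1,…,n}, let P be a Moore–Penrose pseudoinverse of A_{I,:} and Q a Moore–Penrose pseudoinverse of B_{:,J}, and assume A_{I,:} X* B_{:,J} = C_{I,J}. For X ∈ ℝ^{p×q}, the GRBK update X' = X + P (C_{I,J} − A_{I,:} X B_{:,J}) Q satisfies the orthogonality relation ⟨X' − X, X' − X*⟩_F = 0. -/
open Matrix

/-- orthogonality relation `⟨X' − X, X' − X*⟩_F = 0` for the GRBK update. -/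
theorem grbk_orthogonality {m p q n : ℕ}
    (A : Matrix (Fin m) (Fin p) ℝ) (B : Matrix (Fin q) (Fin n) ℝ)
    (Xs : Matrix (Fin p) (Fin q) ℝ) (C : Matrix (Fin m) (Fin n) ℝ) (hC : C = A * Xs * B)
    (I : Finset (Fin m)) (J : Finset (Fin n))
    (P : Matrix (Fin p) {i // i ∈ I} ℝ) (Q : Matrix {j // j ∈ J} (Fin q) ℝ)
    (hP : IsMPInv (rowSub A I) P) (hQ : IsMPInv (colSub B J) Q)
    (hXs : rowSub A I * Xs * colSub B J = subMat C I J)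
    (X : Matrix (Fin p) (Fin q) ℝ) :
    frobInner ((X + P * (subMat C I J - rowSub A I * X * colSub B J) * Q) - X)
        ((X + P * (subMat C I J - rowSub A I * X * colSub B J) * Q) - Xs) = 0 := by
  obtain ⟨-, hP2, -, hP4⟩ := hP
  obtain ⟨-, hQ2, hQ3, -⟩ := hQ
  rw [← hXs]
  generalize rowSub A I = M at *
  generalize colSub B J = N at *
  have hS : P * M * (P * M) = P * M := by rw [← Matrix.mul_assoc, hP2]
  have hT : N * Q * (N * Q) = N * Q := by rw [Matrix.mul_assoc, ← Matrix.mul_assoc Q N Q, hQ2]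
  have hD : P * (M * Xs * N - M * X * N) * Q = (P * M) * (Xs - X) * (N * Q) := by
    simp only [Matrix.mul_sub, Matrix.sub_mul, Matrix.mul_assoc]
  rw [hD]
  generalize P * M = S at *
  generalize N * Q = T at *
  have e1 : X + S * (Xs - X) * T - X = S * (Xs - X) * T := by abel
  have e2 : X + S * (Xs - X) * T - Xs = S * (Xs - X) * T - (Xs - X) := by abel
  rw [e1, e2]
  generalize Xs - X = E
  have hf : ∀ U V : Matrix (Fin p) (Fin q) ℝ, frobInner U V = (Uᵀ * V).trace := by
    intro U V
    simp only [frobInner, Matrix.trace, Matrix.diag, Matrix.mul_apply, Matrix.transpose_apply]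
    exact Finset.sum_comm
  rw [hf, Matrix.transpose_mul, Matrix.transpose_mul, hP4, hQ3, Matrix.mul_sub, Matrix.trace_sub,
    sub_eq_zero]
  have h1 : T * (Eᵀ * S) * (S * E * T) = (T * (Eᵀ * S * E)) * T := by
    calc T * (Eᵀ * S) * (S * E * T) = T * (Eᵀ * (S * S) * E) * T := by
          simp only [Matrix.mul_assoc]
      _ = _ := by rw [hS]
  rw [h1, Matrix.trace_mul_comm, ← Matrix.mul_assoc, hT]
  simp only [Matrix.mul_assoc]
end

section
/- Let I ⊆ {1,…,m} and J ⊆ {1,…,n}, let P be a Moore–Penrose pseudoinverse of A_{I,:} and Q a Moore–Penrose pseudoinverse of B_{:,J}, and assume A_{I,:} X* B_{:,J} = C_{I,J}. For X ∈ ℝ^{p×q}, the GRBK update X' = X + P (C_{I,J} − A_{I,:} X B_{:,J}) Q satisfies the Pythagorean identity ‖X' − X*‖_F² = ‖X − X*‖_F² − ‖X' − X‖_F². -/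
open Matrix

lemma frobNormSq_eq_trace {α β : Type*} [Fintype α] [Fintype β] (M : Matrix α β ℝ) :
    frobNormSq M = (M * Mᵀ).trace := by
  simp [frobNormSq, Matrix.trace, Matrix.mul_apply, sq]

lemma frob_proj {α β : Type*} [Fintype α] [Fintype β] (D : Matrix α β ℝ)
    (E : Matrix α α ℝ) (F : Matrix β β ℝ) (hE : E * E = E) (hF : F * F = F)
    (hEt : Eᵀ = E) (hFt : Fᵀ = F) :
    frobNormSq (D - E * D * F) = frobNormSq D - frobNormSq (-(E * D * F)) := by
  have h1 : (E * D * F * (E * D * F)ᵀ).trace = (D * (E * D * F)ᵀ).trace := by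
    have e1 : E * D * F * (E * D * F)ᵀ = E * (D * F * Dᵀ * E) := by
      simp only [transpose_mul, hEt, hFt]
      calc E * D * F * (F * (Dᵀ * E)) = E * D * (F * F) * Dᵀ * E := by
            simp only [Matrix.mul_assoc]
        _ = _ := by rw [hF]; simp only [Matrix.mul_assoc]
    have e2 : D * (E * D * F)ᵀ = D * F * Dᵀ * E := by
      simp only [transpose_mul, hEt, hFt, Matrix.mul_assoc]
    rw [e1, e2, trace_mul_comm, Matrix.mul_assoc _ E E, hE]
  have h2 : (E * D * F * Dᵀ).trace = (D * (E * D * F)ᵀ).trace := by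
    rw [← trace_transpose, transpose_mul, transpose_transpose]
  simp only [frobNormSq_eq_trace, transpose_sub, transpose_neg, Matrix.sub_mul, Matrix.mul_sub,
    trace_sub, Matrix.neg_mul, Matrix.mul_neg, neg_neg]
  linarith

/-- Pythagorean identity for the GRBK update. -/
theorem grbk_pythagoras {m p q n : ℕ}
    (A : Matrix (Fin m) (Fin p) ℝ) (B : Matrix (Fin q) (Fin n) ℝ)
    (Xs : Matrix (Fin p) (Fin q) ℝ) (C : Matrix (Fin m) (Fin n) ℝ) (hC : C = A * Xs * B)
    (I : Finset (Fin m)) (J : Finset (Fin n))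
    (P : Matrix (Fin p) {i // i ∈ I} ℝ) (Q : Matrix {j // j ∈ J} (Fin q) ℝ)
    (hP : IsMPInv (rowSub A I) P) (hQ : IsMPInv (colSub B J) Q)
    (hXs : rowSub A I * Xs * colSub B J = subMat C I J)
    (X : Matrix (Fin p) (Fin q) ℝ) :
    frobNormSq ((X + P * (subMat C I J - rowSub A I * X * colSub B J) * Q) - Xs)
      = frobNormSq (X - Xs)
        - frobNormSq ((X + P * (subMat C I J - rowSub A I * X * colSub B J) * Q) - X) := by
  obtain ⟨-, hP2, -, hP4⟩ := hP
  obtain ⟨-, hQ2, hQ3, -⟩ := hQ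
  have key := frob_proj (X - Xs) (P * rowSub A I) (colSub B J * Q)
    (by rw [← Matrix.mul_assoc, hP2])
    (by rw [Matrix.mul_assoc, ← Matrix.mul_assoc Q, hQ2]) hP4 hQ3
  have e : P * (subMat C I J - rowSub A I * X * colSub B J) * Q
      = -(P * rowSub A I * (X - Xs) * (colSub B J * Q)) := by
    rw [← hXs]
    simp only [Matrix.mul_sub, Matrix.sub_mul, Matrix.mul_assoc, neg_sub]
  rw [e, add_sub_cancel_left, ← key]
  congr 1
  abel
end

section
/- Let I ⊆ {1,…,m} and J ⊆ {1,…,n}, let P be a Moore–Penrose pseudoinverse of A_{I,:} and Q a Moore–Penrose pseudoinverse of B_{:,J}, and assume A_{I,:} X* B_{:,J} = C_{I,J}. For X ∈ ℝ^{p×q}, the GRBK update X' = X + P (C_{I,J} − A_{I,:} X B_{:,J}) Q satisfies ‖X' − X‖_F² = ⟨P₁ (X − X*), (X − X*) P₂⟩_F, where P₁ = P A_{I,:} and P₂ = B_{:,J} Q; equivalently, ‖X' − X‖_F² = ‖P₁ (X − X*) P₂‖_F². -/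
open Matrix

theorem frobInner_eq_trace {α β : Type*} [Fintype α] [Fintype β] (U V : Matrix α β ℝ) :
    frobInner U V = (Uᵀ * V).trace := by
  simp only [frobInner, Matrix.trace, Matrix.diag, Matrix.mul_apply, Matrix.transpose_apply]
  exact Finset.sum_comm

theorem frobNormSq_eq_inner {α β : Type*} [Fintype α] [Fintype β] (U : Matrix α β ℝ) :
    frobNormSq U = frobInner U U := by
  simp only [frobInner, frobNormSq, sq]

theorem frobNormSq_neg' {α β : Type*} [Fintype α] [Fintype β] (U : Matrix α β ℝ) :
    frobNormSq (-U) = frobNormSq U := by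
  simp [frobNormSq]

theorem frob_proj_s5 {α β : Type*} [Fintype α] [Fintype β] (S : Matrix α α ℝ) (T : Matrix β β ℝ)
    (E : Matrix α β ℝ) (hS : Sᵀ = S) (hT : Tᵀ = T) (hS2 : S * S = S) (hT2 : T * T = T) :
    frobNormSq (S * E * T) = frobInner (S * E) (E * T) := by
  rw [frobNormSq_eq_inner, frobInner_eq_trace, frobInner_eq_trace]
  simp only [Matrix.transpose_mul, hS, hT]
  have h1 : T * (Eᵀ * S) * (S * E * T) = T * (Eᵀ * S * (E * T)) := by
    calc T * (Eᵀ * S) * (S * E * T) = T * (Eᵀ * (S * S) * (E * T)) := by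
          simp only [Matrix.mul_assoc]
      _ = _ := by rw [hS2]
  rw [h1, Matrix.trace_mul_comm]
  congr 1
  calc Eᵀ * S * (E * T) * T = Eᵀ * S * (E * (T * T)) := by simp only [Matrix.mul_assoc]
    _ = _ := by rw [hT2]

/-- `‖X' − X‖_F² = ⟨P₁(X − X*), (X − X*)P₂⟩_F = ‖P₁(X − X*)P₂‖_F²`
for the GRBK update, where `P₁ = P A_{I,:}` and `P₂ = B_{:,J} Q`. -/
theorem grbk_step_norm {m p q n : ℕ}
    (A : Matrix (Fin m) (Fin p) ℝ) (B : Matrix (Fin q) (Fin n) ℝ)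
    (Xs : Matrix (Fin p) (Fin q) ℝ) (C : Matrix (Fin m) (Fin n) ℝ) (hC : C = A * Xs * B)
    (I : Finset (Fin m)) (J : Finset (Fin n))
    (P : Matrix (Fin p) {i // i ∈ I} ℝ) (Q : Matrix {j // j ∈ J} (Fin q) ℝ)
    (hP : IsMPInv (rowSub A I) P) (hQ : IsMPInv (colSub B J) Q)
    (hXs : rowSub A I * Xs * colSub B J = subMat C I J)
    (X : Matrix (Fin p) (Fin q) ℝ) :
    frobNormSq ((X + P * (subMat C I J - rowSub A I * X * colSub B J) * Q) - X)
        = frobInner ((P * rowSub A I) * (X - Xs)) ((X - Xs) * (colSub B J * Q)) ∧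
    frobNormSq ((X + P * (subMat C I J - rowSub A I * X * colSub B J) * Q) - X)
        = frobNormSq ((P * rowSub A I) * (X - Xs) * (colSub B J * Q)) := by
  have hstep : (X + P * (subMat C I J - rowSub A I * X * colSub B J) * Q) - X
      = -((P * rowSub A I) * (X - Xs) * (colSub B J * Q)) := by
    rw [← hXs, add_sub_cancel_left]
    simp only [Matrix.mul_sub, Matrix.sub_mul, Matrix.mul_assoc, neg_sub]
  obtain ⟨-, hP2, -, hP4⟩ := hP
  obtain ⟨-, hQ2, hQ3, -⟩ := hQ
  rw [hstep, frobNormSq_neg']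
  refine ⟨frob_proj_s5 _ _ _ hP4 hQ3 ?_ ?_, rfl⟩
  · rw [← Matrix.mul_assoc, hP2]
  · rw [Matrix.mul_assoc, ← Matrix.mul_assoc Q, hQ2]
end

section
/- Let σ_A > 0 satisfy ‖A (Aᵀ u)‖₂ ≥ σ_A ‖Aᵀ u‖₂ for every u ∈ ℝ^m, and let σ_B > 0 satisfy ‖Bᵀ (B v)‖₂ ≥ σ_B ‖B v‖₂ for every v ∈ ℝ^n (so σ_A and σ_B are lower bounds for the smallest nonzero singular values of A and B). If Z ∈ ℝ^{p×q} has the form Z = Aᵀ W Bᵀ for some W ∈ ℝ^{m×n}, then ‖A Z B‖_F ≥ σ_A σ_B ‖Z‖_F. -/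
open Matrix

theorem aux_frobNorm_transpose {α β : Type*} [Fintype α] [Fintype β] (M : Matrix α β ℝ) :
    frobNorm Mᵀ = frobNorm M := by
  unfold frobNorm frobNormSq
  rw [Finset.sum_comm]
  rfl

theorem aux_frobNorm_mul_lower {α β γ : Type*} [Fintype α] [Fintype β] [Fintype γ]
    (C : Matrix α β ℝ) (D : Matrix β α ℝ) (σ : ℝ) (hσ : 0 < σ)
    (h : ∀ u : α → ℝ, σ * vecNorm (D.mulVec u) ≤ vecNorm (C.mulVec (D.mulVec u)))
    (X : Matrix α γ ℝ) : σ * frobNorm (D * X) ≤ frobNorm (C * (D * X)) := by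
  have h2 : ∀ u : α → ℝ, σ ^ 2 * vecNormSq (D.mulVec u) ≤ vecNormSq (C.mulVec (D.mulVec u)) := by
    intro u
    have nn1 : 0 ≤ vecNormSq (D.mulVec u) := Finset.sum_nonneg fun i _ => sq_nonneg _
    have nn2 : 0 ≤ vecNormSq (C.mulVec (D.mulVec u)) := Finset.sum_nonneg fun i _ => sq_nonneg _
    have h1 := pow_le_pow_left₀ (mul_nonneg hσ.le (Real.sqrt_nonneg _)) (h u) 2
    unfold vecNorm at h1
    rwa [mul_pow, Real.sq_sqrt nn1, Real.sq_sqrt nn2] at h1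
  unfold frobNorm
  apply Real.le_sqrt_of_sq_le
  have nn : 0 ≤ frobNormSq (D * X) :=
    (Finset.sum_nonneg fun i _ => Finset.sum_nonneg fun j _ => sq_nonneg _)
  rw [mul_pow, Real.sq_sqrt nn]
  unfold frobNormSq
  rw [Finset.sum_comm, Finset.sum_comm (s := (Finset.univ : Finset α)), Finset.mul_sum]
  exact Finset.sum_le_sum fun j _ => h2 (fun i => X i j)

/-- if `σ_A, σ_B` lower-bound the action of `A` and `B` on the relevant row
and column spaces, then `‖A Z B‖_F ≥ σ_A σ_B ‖Z‖_F` for every `Z = Aᵀ W Bᵀ`. -/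
theorem sandwich_norm_lower_bound {m p q n : ℕ}
    (A : Matrix (Fin m) (Fin p) ℝ) (B : Matrix (Fin q) (Fin n) ℝ)
    (σA σB : ℝ) (hσA : 0 < σA) (hσB : 0 < σB)
    (hA : ∀ u : Fin m → ℝ, σA * vecNorm (Aᵀ.mulVec u) ≤ vecNorm (A.mulVec (Aᵀ.mulVec u)))
    (hB : ∀ v : Fin n → ℝ, σB * vecNorm (B.mulVec v) ≤ vecNorm (Bᵀ.mulVec (B.mulVec v)))
    (Z : Matrix (Fin p) (Fin q) ℝ) (W : Matrix (Fin m) (Fin n) ℝ)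
    (hZ : Z = Aᵀ * W * Bᵀ) :
    σA * σB * frobNorm Z ≤ frobNorm (A * Z * B) := by
  subst hZ
  have h1 := aux_frobNorm_mul_lower A Aᵀ σA hσA hA (W * Bᵀ * B)
  have h2 := aux_frobNorm_mul_lower Bᵀ B σB hσB hB (Wᵀ * A)
  have e1 : A * (Aᵀ * W * Bᵀ) * B = A * (Aᵀ * (W * Bᵀ * B)) := by
    simp only [Matrix.mul_assoc]
  have e2 : B * (Wᵀ * A) = (Aᵀ * W * Bᵀ)ᵀ := by
    simp [Matrix.transpose_mul]
  have e3 : Bᵀ * (B * (Wᵀ * A)) = (Aᵀ * (W * Bᵀ * B))ᵀ := by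
    simp [Matrix.transpose_mul, Matrix.mul_assoc]
  rw [e3, e2, aux_frobNorm_transpose, aux_frobNorm_transpose] at h2
  rw [e1, mul_assoc]
  exact (mul_le_mul_of_nonneg_left h2 hσA.le).trans h1
end

section
/- Assume every row A_{i,:} of A and every column B_{:,j} of B is nonzero, let σ_A > 0 satisfy ‖A (Aᵀ u)‖₂ ≥ σ_A ‖Aᵀ u‖₂ for every u ∈ ℝ^m and σ_B > 0 satisfy ‖Bᵀ (B v)‖₂ ≥ σ_B ‖B v‖₂ for every v ∈ ℝ^n. Let X ∈ ℝ^{p×q} satisfy X − X* = Aᵀ W Bᵀ for some W ∈ ℝ^{m×n}. For each pair (i,j) ∈ {1,…,m}×{1,…,n} define the GRK update X'_{(i,j)} = X + (A_{i,:})ᵀ (C_{ij} − A_{i,:} X B_{:,j}) (B_{:,j})ᵀ / (‖A_{i,:}‖₂² ‖B_{:,j}‖₂²). Then the expected squared error after one GRK step, with (i,j) chosen with probability ‖A_{i,:}‖₂² ‖B_{:,j}‖₂² / (‖A‖_F² ‖B‖_F²), satisfies ∑_{i=1}^m ∑_{j=1}^n (‖A_{i,:}‖₂² ‖B_{:,j}‖₂²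 / (‖A‖_F² ‖B‖_F²)) ‖X'_{(i,j)} − X*‖_F² ≤ (1 − σ_A² σ_B² / (‖A‖_F² ‖B‖_F²)) ‖X − X*‖_F². -/
open Matrix

/-- The GRK update for the index pair `ij`. -/
noncomputable def grkStep {m p q n : ℕ} (A : Matrix (Fin m) (Fin p) ℝ)
    (B : Matrix (Fin q) (Fin n) ℝ) (C : Matrix (Fin m) (Fin n) ℝ)
    (ij : Fin m × Fin n) (X : Matrix (Fin p) (Fin q) ℝ) : Matrix (Fin p) (Fin q) ℝ :=
  X + (1 / (vecNormSq (A ij.1) * vecNormSq (fun b => B b ij.2))) •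
    rank1 A B ij.1 ij.2 (C ij.1 ij.2 - bilin A B X ij.1 ij.2)

lemma frob_lower {m p k l : ℕ} (M : Matrix (Fin m) (Fin p) ℝ) (N : Matrix (Fin p) (Fin k) ℝ)
    (σ : ℝ) (hσ : 0 < σ)
    (h : ∀ u : Fin k → ℝ, σ * vecNorm (N.mulVec u) ≤ vecNorm (M.mulVec (N.mulVec u)))
    (Y : Matrix (Fin k) (Fin l) ℝ) :
    σ ^ 2 * frobNormSq (N * Y) ≤ frobNormSq (M * (N * Y)) := by
  have nn : ∀ {r : ℕ} (x : Fin r → ℝ), 0 ≤ vecNormSq x := fun x =>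
    Finset.sum_nonneg fun _ _ => sq_nonneg _
  have col : ∀ {r : ℕ} (Z : Matrix (Fin r) (Fin l) ℝ),
      frobNormSq Z = ∑ j, vecNormSq (fun i => Z i j) := fun Z => Finset.sum_comm
  rw [col, col, Finset.mul_sum]
  refine Finset.sum_le_sum fun j _ => ?_
  have h1 := h (fun i => Y i j)
  have e1 : N.mulVec (fun i => Y i j) = fun i => (N * Y) i j := rfl
  have e2 : M.mulVec (fun i => (N * Y) i j) = fun i => (M * (N * Y)) i j := rfl
  rw [e1, e2] at h1
  have h2 := pow_le_pow_left₀ (mul_nonneg hσ.le (Real.sqrt_nonneg _)) h1 2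
  rw [mul_pow] at h2
  unfold vecNorm at h2
  rwa [Real.sq_sqrt (nn _), Real.sq_sqrt (nn _)] at h2

lemma frob_transpose {a b : ℕ} (M : Matrix (Fin a) (Fin b) ℝ) :
    frobNormSq Mᵀ = frobNormSq M := Finset.sum_comm

lemma bilin_eq {m p q n : ℕ} (A : Matrix (Fin m) (Fin p) ℝ) (B : Matrix (Fin q) (Fin n) ℝ)
    (X : Matrix (Fin p) (Fin q) ℝ) (i : Fin m) (j : Fin n) :
    bilin A B X i j = (A * X * B) i j := by
  simp only [bilin, Matrix.mul_apply, Finset.sum_mul]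
  exact Finset.sum_comm

lemma vecNormSq_pos {r : ℕ} (x : Fin r → ℝ) (h : x ≠ 0) : 0 < vecNormSq x := by
  obtain ⟨i, hi⟩ := Function.ne_iff.mp h
  exact Finset.sum_pos' (fun _ _ => sq_nonneg _) ⟨i, Finset.mem_univ _, by
    have : x i ≠ 0 := hi
    positivity⟩

lemma step_err {m p q n : ℕ}
    (A : Matrix (Fin m) (Fin p) ℝ) (B : Matrix (Fin q) (Fin n) ℝ)
    (Xs X : Matrix (Fin p) (Fin q) ℝ) (i : Fin m) (j : Fin n)
    (hA : A i ≠ 0) (hB : (fun b => B b j) ≠ 0) :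
    vecNormSq (A i) * vecNormSq (fun b => B b j) *
      frobNormSq (grkStep A B (A * Xs * B) (i, j) X - Xs) =
    vecNormSq (A i) * vecNormSq (fun b => B b j) * frobNormSq (X - Xs)
      - ((A * (X - Xs) * B) i j) ^ 2 := by
  have ha := vecNormSq_pos _ hA
  have hb := vecNormSq_pos _ hB
  have hab : vecNormSq (A i) * vecNormSq (fun b => B b j) =
      ∑ a, ∑ b, (A i a * B b j) ^ 2 := by
    simp only [vecNormSq, Finset.sum_mul_sum, mul_pow]
  have hR : (A * (X - Xs) * B) i j = ∑ a, ∑ b, (X - Xs) a b * (A i a * B b j) := by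
    rw [← bilin_eq]
    exact Finset.sum_congr rfl fun a _ => Finset.sum_congr rfl fun b _ => by ring
  have hr : (A * Xs * B) i j - bilin A B X i j = - (A * (X - Xs) * B) i j := by
    rw [bilin_eq, Matrix.mul_sub, Matrix.sub_mul, Matrix.sub_apply]; ring
  have key : ∀ t : ℝ, ∑ a, ∑ b, ((X - Xs) a b - t * (A i a * B b j)) ^ 2 =
      frobNormSq (X - Xs) - 2 * t * (A * (X - Xs) * B) i j
        + t ^ 2 * (vecNormSq (A i) * vecNormSq (fun b => B b j)) := by
    intro t
    rw [hab, hR, frobNormSq]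
    simp only [Finset.mul_sum, ← Finset.sum_sub_distrib, ← Finset.sum_add_distrib]
    exact Finset.sum_congr rfl fun a _ => Finset.sum_congr rfl fun b _ => by ring
  have e : frobNormSq (grkStep A B (A * Xs * B) (i, j) X - Xs) =
      ∑ a, ∑ b, ((X - Xs) a b - ((A * (X - Xs) * B) i j /
        (vecNormSq (A i) * vecNormSq (fun b => B b j))) * (A i a * B b j)) ^ 2 := by
    refine Finset.sum_congr rfl fun a _ => Finset.sum_congr rfl fun b _ => ?_
    simp only [grkStep, rank1, hr, Matrix.sub_apply, Matrix.add_apply, Matrix.smul_apply,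
      Matrix.of_apply, smul_eq_mul]
    ring
  rw [e, key]
  have := (mul_pos ha hb).ne'
  generalize vecNormSq (A i) * vecNormSq (fun b => B b j) = c at *
  field_simp
  ring

/-- one-step expected squared error bound for the global randomized
Kaczmarz (GRK) method. -/
theorem grk_one_step_expected_error {m p q n : ℕ}
    (A : Matrix (Fin m) (Fin p) ℝ) (B : Matrix (Fin q) (Fin n) ℝ)
    (Xs : Matrix (Fin p) (Fin q) ℝ) (C : Matrix (Fin m) (Fin n) ℝ) (hC : C = A * Xs * B)
    (hAnz : ∀ i, A i ≠ 0) (hBnz : ∀ j, (fun b => B b j) ≠ 0)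
    (σA σB : ℝ) (hσA : 0 < σA) (hσB : 0 < σB)
    (hA : ∀ u : Fin m → ℝ, σA * vecNorm (Aᵀ.mulVec u) ≤ vecNorm (A.mulVec (Aᵀ.mulVec u)))
    (hB : ∀ v : Fin n → ℝ, σB * vecNorm (B.mulVec v) ≤ vecNorm (Bᵀ.mulVec (B.mulVec v)))
    (X : Matrix (Fin p) (Fin q) ℝ) (W : Matrix (Fin m) (Fin n) ℝ)
    (hX : X - Xs = Aᵀ * W * Bᵀ) :
    ∑ i, ∑ j,
        (vecNormSq (A i) * vecNormSq (fun b => B b j) / (frobNormSq A * frobNormSq B)) *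
          frobNormSq (grkStep A B C (i, j) X - Xs)
      ≤ (1 - σA ^ 2 * σB ^ 2 / (frobNormSq A * frobNormSq B)) * frobNormSq (X - Xs) := by
  subst hC
  have hlow : σA ^ 2 * σB ^ 2 * frobNormSq (X - Xs) ≤ frobNormSq (A * (X - Xs) * B) := by
    have h1 := frob_lower A Aᵀ σA hσA hA (W * Bᵀ * B)
    have h2 := frob_lower Bᵀ B σB hσB hB (Wᵀ * A)
    have e1 : Aᵀ * (W * Bᵀ * B) = (X - Xs) * B := by rw [hX]; simp only [Matrix.mul_assoc]
    have e2 : B * (Wᵀ * A) = (X - Xs)ᵀ := by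
      rw [hX]; simp [Matrix.transpose_mul]
    rw [e1, ← Matrix.mul_assoc] at h1
    rw [e2, ← Matrix.transpose_mul, frob_transpose, frob_transpose] at h2
    nlinarith [mul_le_mul_of_nonneg_left h2 (sq_nonneg σA)]
  have hF : frobNormSq A * frobNormSq B =
      ∑ i, ∑ j, vecNormSq (A i) * vecNormSq (fun b => B b j) := by
    rw [← Finset.sum_mul_sum, ← frob_transpose B]
    rfl
  have hF0 : 0 ≤ frobNormSq A * frobNormSq B :=
    mul_nonneg (Finset.sum_nonneg fun _ _ => Finset.sum_nonneg fun _ _ => sq_nonneg _)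
      (Finset.sum_nonneg fun _ _ => Finset.sum_nonneg fun _ _ => sq_nonneg _)
  have hE0 : 0 ≤ frobNormSq (X - Xs) :=
    Finset.sum_nonneg fun _ _ => Finset.sum_nonneg fun _ _ => sq_nonneg _
  have hsum : ∑ i, ∑ j,
        (vecNormSq (A i) * vecNormSq (fun b => B b j) / (frobNormSq A * frobNormSq B)) *
          frobNormSq (grkStep A B (A * Xs * B) (i, j) X - Xs) =
      (frobNormSq A * frobNormSq B * frobNormSq (X - Xs) - frobNormSq (A * (X - Xs) * B)) /
        (frobNormSq A * frobNormSq B) := by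
    have : ∀ i j, (vecNormSq (A i) * vecNormSq (fun b => B b j) /
        (frobNormSq A * frobNormSq B)) * frobNormSq (grkStep A B (A * Xs * B) (i, j) X - Xs) =
        (vecNormSq (A i) * vecNormSq (fun b => B b j) * frobNormSq (X - Xs)
      - ((A * (X - Xs) * B) i j) ^ 2) / (frobNormSq A * frobNormSq B) := by
      intro i j
      rw [← step_err A B Xs X i j (hAnz i) (hBnz j)]
      ring
    simp only [this, ← Finset.sum_div, Finset.sum_sub_distrib, ← Finset.sum_mul, ← hF]
    rfl
  rw [hsum]
  rcases hF0.eq_or_lt with h | h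
  · rw [← h]
    simpa using hE0
  · rw [div_le_iff₀ h]
    have : (1 - σA ^ 2 * σB ^ 2 / (frobNormSq A * frobNormSq B)) * frobNormSq (X - Xs) *
        (frobNormSq A * frobNormSq B) = frobNormSq A * frobNormSq B * frobNormSq (X - Xs) -
        σA ^ 2 * σB ^ 2 * frobNormSq (X - Xs) := by
      generalize frobNormSq A * frobNormSq B = F at *
      field_simp
    rw [this]
    linarith
end

section
/- Let I ⊆ {1,…,m} and J ⊆ {1,…,n} with A_{i,:} ≠ 0 for all i ∈ I and B_{:,j} ≠ 0 for all j ∈ J, let α ∈ ℝ and u_i (i ∈ I), v_j (j ∈ J) be arbitrary real weights, and let C ∈ ℝ^{m×n} be arbitrary. If X − X* = Aᵀ W Bᵀ for some W ∈ ℝ^{m×n}, then the GRABK update X' = X + α ∑_{i ∈ I, j ∈ J} u_i v_j (A_{i,:})ᵀ (C_{ij} − A_{i,:} X B_{:,j}) (B_{:,j})ᵀ / (‖A_{i,:}‖₂² ‖B_{:,j}‖₂²) also satisfies X' − X* = Aᵀ W' Bᵀ for some W' ∈ ℝ^{m×n}; that is, the GRABK iteration preserves membership of the error X − X* in the subspace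 {Aᵀ W Bᵀ : W ∈ ℝ^{m×n}}. -/
open Matrix

/-- the GRABK iteration preserves membership of the error `X − X*` in the
subspace `{Aᵀ W Bᵀ : W}`. -/
theorem grabk_preserves_error_subspace {m p q n : ℕ}
    (A : Matrix (Fin m) (Fin p) ℝ) (B : Matrix (Fin q) (Fin n) ℝ)
    (Xs X : Matrix (Fin p) (Fin q) ℝ) (C : Matrix (Fin m) (Fin n) ℝ)
    (I : Finset (Fin m)) (J : Finset (Fin n))
    (hAnz : ∀ i ∈ I, A i ≠ 0) (hBnz : ∀ j ∈ J, (fun b => B b j) ≠ 0)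
    (α : ℝ) (u : Fin m → ℝ) (v : Fin n → ℝ)
    (W : Matrix (Fin m) (Fin n) ℝ) (hX : X - Xs = Aᵀ * W * Bᵀ) :
    ∃ W' : Matrix (Fin m) (Fin n) ℝ,
      (X + α • ∑ i ∈ I, ∑ j ∈ J,
          (u i * v j / (vecNormSq (A i) * vecNormSq (fun b => B b j))) •
            rank1 A B i j (C i j - bilin A B X i j)) - Xs = Aᵀ * W' * Bᵀ := by
  have key : ∀ i j s, rank1 A B i j s = Aᵀ * Matrix.single i j s * Bᵀ := by
    intro i j s
    ext a b
    rw [Matrix.mul_assoc, Matrix.mul_apply, Finset.sum_eq_single i]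
    · simp [rank1, mul_assoc]
    · intro k _ hk
      simp [hk]
    · simp
  refine ⟨W + α • ∑ i ∈ I, ∑ j ∈ J,
    (u i * v j / (vecNormSq (A i) * vecNormSq (fun b => B b j))) •
      Matrix.single i j (C i j - bilin A B X i j), ?_⟩
  rw [add_sub_right_comm, hX]
  simp only [key, Matrix.mul_add, Matrix.add_mul, Matrix.mul_smul, Matrix.smul_mul,
    Matrix.mul_sum, Matrix.sum_mul]
end

section
/- Let I ⊆ {1,…,m} and J ⊆ {1,…,n} be nonempty with A_{i,:} ≠ 0 for all i ∈ I and B_{:,j} ≠ 0 for all j ∈ J. With the weights u_i = ‖A_{i,:}‖₂²/‖A_{I,:}‖_F² (i ∈ I) and v_j = ‖B_{:,j}‖₂²/‖B_{:,J}‖_F² (j ∈ J), for every X ∈ ℝ^{p×q} the weighted GRABK direction collapses to a compact form: ∑_{i ∈ I, j ∈ J} u_i v_j (A_{i,:})ᵀ (C_{ij} − A_{i,:} X B_{:,j}) (B_{:,j})ᵀ / (‖A_{i,:}‖₂² ‖B_{:,j}‖₂²) = (A_{I,:})ᵀ (C_{I,J} − A_{I,:} X B_{:,J}) (B_{:,J})ᵀ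 / (‖A_{I,:}‖_F² ‖B_{:,J}‖_F²). -/
open Matrix

/-- with the weights `u_i = ‖A_{i,:}‖²/‖A_{I,:}‖_F²` and
`v_j = ‖B_{:,j}‖²/‖B_{:,J}‖_F²`, the weighted GRABK direction collapses to the compact
form `(A_{I,:})ᵀ (C_{I,J} − A_{I,:} X B_{:,J}) (B_{:,J})ᵀ / (‖A_{I,:}‖_F² ‖B_{:,J}‖_F²)`. -/
theorem grabk_compact_direction {m p q n : ℕ}
    (A : Matrix (Fin m) (Fin p) ℝ) (B : Matrix (Fin q) (Fin n) ℝ)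
    (C : Matrix (Fin m) (Fin n) ℝ)
    (I : Finset (Fin m)) (J : Finset (Fin n)) (hIne : I.Nonempty) (hJne : J.Nonempty)
    (hAnz : ∀ i ∈ I, A i ≠ 0) (hBnz : ∀ j ∈ J, (fun b => B b j) ≠ 0)
    (X : Matrix (Fin p) (Fin q) ℝ) :
    ∑ i ∈ I, ∑ j ∈ J,
        ((vecNormSq (A i) / frobNormSq (rowSub A I)) *
            (vecNormSq (fun b => B b j) / frobNormSq (colSub B J)) /
          (vecNormSq (A i) * vecNormSq (fun b => B b j))) •
          rank1 A B i j (C i j - bilin A B X i j)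
      = (1 / (frobNormSq (rowSub A I) * frobNormSq (colSub B J))) •
          ((rowSub A I)ᵀ * (subMat C I J - rowSub A I * X * colSub B J) * (colSub B J)ᵀ) := by
  have hpos : ∀ {k : ℕ} (x : Fin k → ℝ), x ≠ 0 → vecNormSq x ≠ 0 := by
    intro k x hx h
    apply hx
    unfold vecNormSq at h
    rw [Finset.sum_eq_zero_iff_of_nonneg (fun i _ => sq_nonneg (x i))] at h
    funext i
    exact pow_eq_zero_iff (two_ne_zero) |>.mp (h i (Finset.mem_univ i))
  have hbil : ∀ (i : {i // i ∈ I}) (j : {j // j ∈ J}),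
      (subMat C I J - rowSub A I * X * colSub B J) i j
        = C i.val j.val - bilin A B X i.val j.val := by
    intro i j
    simp only [Matrix.sub_apply, Matrix.mul_apply, subMat, rowSub, colSub, bilin,
      Matrix.submatrix_apply, id, Finset.sum_mul]
    rw [Finset.sum_comm]
  ext a b
  rw [Matrix.smul_apply, Matrix.mul_apply]
  simp only [Matrix.mul_apply (M := (rowSub A I)ᵀ), hbil, Matrix.sum_apply, Matrix.smul_apply,
    smul_eq_mul, Finset.sum_mul, Finset.mul_sum]
  rw [Finset.sum_comm' (t' := J) (s' := fun _ => I) (by intro x y; tauto)]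
  rw [← Finset.sum_coe_sort J]
  refine Finset.sum_congr rfl fun j _ => ?_
  rw [← Finset.sum_coe_sort I]
  refine Finset.sum_congr rfl fun i _ => ?_
  have h1 := hpos _ (hAnz i.val i.property)
  have h2 := hpos _ (hBnz j.val j.property)
  have h3 : ∀ u v f g : ℝ, u ≠ 0 → v ≠ 0 → u / f * (v / g) / (u * v) = 1 / (f * g) := by
    intro u v f g hu hv
    rw [div_mul_div_comm, div_right_comm, div_self (mul_ne_zero hu hv)]
  rw [h3 _ _ _ _ h1 h2]
  simp only [rank1, Matrix.of_apply, Matrix.transpose_apply]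
  rfl
end

section
/- Let I ⊆ {1,…,m} and J ⊆ {1,…,n} be nonempty, assume C_{ij} = A_{i,:} X* B_{:,j} for all i ∈ I, j ∈ J, and let û_i (i ∈ I), v̂_j (j ∈ J) be nonnegative reals. Define the search direction S = ∑_{i ∈ I, j ∈ J} û_i v̂_j (A_{i,:})ᵀ (C_{ij} − A_{i,:} X B_{:,j}) (B_{:,j})ᵀ and the scalar r = ∑_{i ∈ I, j ∈ J} û_i v̂_j (C_{ij} − A_{i,:} X B_{:,j})². If S ≠ 0, set L = r / ‖S‖_F², and for η ∈ ℝ define the adaptive-stepsize update X' = X + η L S. Then ‖X' − X*‖_F² = ‖X − X*‖_F² − η(2−η) L r. -/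
open Matrix

theorem frobNormSq_step {α β : Type*} [Fintype α] [Fintype β] (D S : Matrix α β ℝ) (t : ℝ) :
    frobNormSq (D + t • S) = frobNormSq D + 2 * t * frobInner S D + t ^ 2 * frobNormSq S := by
  simp only [frobNormSq, frobInner, Finset.mul_sum, ← Finset.sum_add_distrib]
  refine Finset.sum_congr rfl fun a _ => Finset.sum_congr rfl fun b _ => ?_
  simp only [Matrix.add_apply, Matrix.smul_apply, smul_eq_mul]
  ring

theorem frobInner_sum_left {α β ι : Type*} [Fintype α] [Fintype β] (s : Finset ι)
    (f : ι → Matrix α β ℝ) (D : Matrix α β ℝ) :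
    frobInner (∑ i ∈ s, f i) D = ∑ i ∈ s, frobInner (f i) D := by
  simp only [frobInner, Matrix.sum_apply, Finset.sum_mul]
  rw [Finset.sum_comm]
  rw [Finset.sum_comm]
  rw [Finset.sum_comm (s := s)]
  exact Finset.sum_congr rfl fun a _ => Finset.sum_comm

theorem frobInner_rank1 {m p q n : ℕ} (A : Matrix (Fin m) (Fin p) ℝ)
    (B : Matrix (Fin q) (Fin n) ℝ) (X Xs : Matrix (Fin p) (Fin q) ℝ) (i : Fin m) (j : Fin n)
    (c s : ℝ) :
    frobInner (c • rank1 A B i j s) (X - Xs) = c * s * (bilin A B X i j - bilin A B Xs i j) := by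
  simp only [frobInner, bilin, rank1, ← Finset.sum_sub_distrib, Finset.mul_sum]
  refine Finset.sum_congr rfl fun a _ => Finset.sum_congr rfl fun b _ => ?_
  simp only [Matrix.sub_apply, Matrix.smul_apply, smul_eq_mul, Matrix.of_apply]
  ring

theorem frobNormSq_ne_zero {α β : Type*} [Fintype α] [Fintype β] (S : Matrix α β ℝ)
    (hS : S ≠ 0) : frobNormSq S ≠ 0 := by
  intro h
  apply hS
  ext a b
  unfold frobNormSq at h
  have h1 := (Finset.sum_eq_zero_iff_of_nonneg
    (fun i _ => Finset.sum_nonneg fun j _ => sq_nonneg (S i j))).1 h a (Finset.mem_univ a)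
  have h2 := (Finset.sum_eq_zero_iff_of_nonneg
    (fun j _ => sq_nonneg (S a j))).1 h1 b (Finset.mem_univ b)
  simpa using h2

/-- exact single-step decrease of the squared error for the GRABK method
with adaptive stepsize `α = η L`, `L = r/‖S‖_F²`. -/
theorem grabk_adaptive_step_identity {m p q n : ℕ}
    (A : Matrix (Fin m) (Fin p) ℝ) (B : Matrix (Fin q) (Fin n) ℝ)
    (Xs X : Matrix (Fin p) (Fin q) ℝ) (C : Matrix (Fin m) (Fin n) ℝ)
    (I : Finset (Fin m)) (J : Finset (Fin n)) (hIne : I.Nonempty) (hJne : J.Nonempty)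
    (hCons : ∀ i ∈ I, ∀ j ∈ J, C i j = bilin A B Xs i j)
    (uh : Fin m → ℝ) (vh : Fin n → ℝ)
    (huh : ∀ i ∈ I, 0 ≤ uh i) (hvh : ∀ j ∈ J, 0 ≤ vh j)
    (S : Matrix (Fin p) (Fin q) ℝ)
    (hSdef : S = ∑ i ∈ I, ∑ j ∈ J,
      (uh i * vh j) • rank1 A B i j (C i j - bilin A B X i j))
    (r : ℝ)
    (hrdef : r = ∑ i ∈ I, ∑ j ∈ J, uh i * vh j * (C i j - bilin A B X i j) ^ 2)
    (hS : S ≠ 0) (η : ℝ) :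
    frobNormSq ((X + (η * (r / frobNormSq S)) • S) - Xs)
      = frobNormSq (X - Xs) - η * (2 - η) * (r / frobNormSq S) * r := by
  have hne := frobNormSq_ne_zero S hS
  have hin : frobInner S (X - Xs) = -r := by
    rw [hrdef, hSdef, frobInner_sum_left, ← Finset.sum_neg_distrib]
    refine Finset.sum_congr rfl fun i hi => ?_
    rw [frobInner_sum_left, ← Finset.sum_neg_distrib]
    refine Finset.sum_congr rfl fun j hj => ?_
    rw [frobInner_rank1, hCons i hi j hj]
    ring
  rw [add_sub_right_comm, frobNormSq_step, hin]
  field_simp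
  ring
end
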